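/- In PSU_3(8), the group Q_2 = ⟨Ā, B̄, C̄⟩ (images of A = [[0,0,1],[1,0,0],[0,1,0]], B = diag(1,α,α^{-1}), C = diag(β,β^4,β^4)) is a group of order 27 and exponent 3 whose center and commutator subgroup both equal ⟨B̄⟩ of order 3; in particular Q_2 is extraspecial of order 27 and exponent 3. -/

import Mathlib

open Matrix

/-- The set of matrices in GL₃(F) of determinant 1 preserving the Hermitian
form (x,y) = Σᵢ xᵢ·yᵢ⁸.  This set is closed under the group operations, so the
subgroup it generates is exactly SU₃(8) when `F` is the field with 64
elements. -/
def SU3 (F : Type*) [Field F] : Subgroup (GL (Fin 3) F) :=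
  Subgroup.closure {M : GL (Fin 3) F |
    (M : Matrix (Fin 3) (Fin 3) F).det = 1 ∧
    ∀ x y : Fin 3 → F,
      (∑ i, (M : Matrix (Fin 3) (Fin 3) F).mulVec x i *
        ((M : Matrix (Fin 3) (Fin 3) F).mulVec y i) ^ 8) = ∑ i, x i * (y i) ^ 8}

/-- PSU₃ : the quotient of SU₃ by its center. -/
def PSU3 (F : Type*) [Field F] : Type _ :=
  ↥(SU3 F) ⧸ Subgroup.center ↥(SU3 F)

instance (F : Type*) [Field F] : Group (PSU3 F) :=
  inferInstanceAs (Group (↥(SU3 F) ⧸ Subgroup.center ↥(SU3 F)))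

/-- The projection SU₃(F) → PSU₃(F). -/
def psuProj (F : Type*) [Field F] : ↥(SU3 F) →* PSU3 F :=
  QuotientGroup.mk' (Subgroup.center ↥(SU3 F))

/-- For elements satisfying the Heisenberg relations, products of powers are
straightened into the normal form `b ^ k * c ^ j * a ^ i`. -/
theorem pow_mul_pow_of_heisenberg {G : Type*} [Group G] {a b c : G} (hab : Commute a b)
    (hbc : Commute b c) (hac : a * c = b * c * a) (i j : ℕ) :
    a ^ i * c ^ j = b ^ (i * j) * c ^ j * a ^ i := by
  have key (j : ℕ) : a * c ^ j = b ^ j * c ^ j * a := by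
    induction j with
    | zero => simp
    | succ j ih =>
      calc a * c ^ (j + 1) = a * c ^ j * c := by rw [pow_succ, mul_assoc]
        _ = b ^ j * c ^ j * (a * c) := by rw [ih]; simp only [mul_assoc]
        _ = b ^ j * (c ^ j * b) * c * a := by rw [hac]; simp only [mul_assoc]
        _ = b ^ (j + 1) * c ^ (j + 1) * a := by
          rw [← (hbc.pow_right j).eq]; simp only [pow_succ, mul_assoc]
  induction i with
  | zero => simp
  | succ i ih =>
    calc a ^ (i + 1) * c ^ j = a * (a ^ i * c ^ j) := by rw [pow_succ', mul_assoc]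
      _ = a * b ^ (i * j) * c ^ j * a ^ i := by rw [ih]; simp only [mul_assoc]
      _ = b ^ (i * j) * (a * c ^ j) * a ^ i := by
        rw [(hab.pow_right _).eq]; simp only [mul_assoc]
      _ = b ^ (i * j + j) * c ^ j * (a * a ^ i) := by
        rw [key, pow_add]; simp only [mul_assoc]
      _ = b ^ ((i + 1) * j) * c ^ j * a ^ (i + 1) := by rw [← pow_succ', Nat.succ_mul]

theorem normalForm_mul_of_heisenberg {G : Type*} [Group G] {a b c : G} (hab : Commute a b)
    (hbc : Commute b c) (hac : a * c = b * c * a) (k j i k' j' i' : ℕ) :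
    b ^ k * c ^ j * a ^ i * (b ^ k' * c ^ j' * a ^ i') =
      b ^ (k + k' + i * j') * c ^ (j + j') * a ^ (i + i') := by
  have h1 : a ^ i * b ^ k' = b ^ k' * a ^ i := (hab.pow_pow i k').eq
  have h2 (m : ℕ) : c ^ j * b ^ m = b ^ m * c ^ j := (hbc.pow_pow m j).eq.symm
  calc b ^ k * c ^ j * a ^ i * (b ^ k' * c ^ j' * a ^ i')
      = b ^ k * c ^ j * (a ^ i * b ^ k') * c ^ j' * a ^ i' := by simp only [mul_assoc]
    _ = b ^ k * (c ^ j * b ^ k') * (a ^ i * c ^ j') * a ^ i' := by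
      rw [h1]; simp only [mul_assoc]
    _ = b ^ k * b ^ k' * (c ^ j * b ^ (i * j')) * c ^ j' * a ^ i * a ^ i' := by
      rw [h2, pow_mul_pow_of_heisenberg hab hbc hac]; simp only [mul_assoc]
    _ = _ := by rw [h2]; simp only [pow_add, mul_assoc]

open scoped commutatorElement in
/-- Three elements of order dividing `3` satisfying the Heisenberg relations with `b ≠ 1`
generate an extraspecial group of order `27` and exponent `3` with center `⟨b⟩`. -/
theorem extraspecial_of_heisenberg {G : Type*} [Group G] {a b c : G} (ha : a ^ 3 = 1)
    (hb : b ^ 3 = 1) (hc : c ^ 3 = 1) (hb1 : b ≠ 1) (hab : Commute a b) (hbc : Commute b c)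
    (hac : a * c = b * c * a) :
    let Q := Subgroup.closure {a, b, c}
    let Z := Subgroup.closure {b}
    Nat.card Q = 27 ∧ (∀ g ∈ Q, g ^ 3 = 1) ∧
      {g | g ∈ Q ∧ ∀ h ∈ Q, g * h = h * g} = (Z : Set G) ∧ ⁅Q, Q⁆ = Z ∧ Nat.card Z = 3 := by
  intro Q Z
  have hbo : orderOf b = 3 := orderOf_eq_prime hb hb1
  have mul := normalForm_mul_of_heisenberg hab hbc hac
  have cube (k j i : ℕ) : (b ^ k * c ^ j * a ^ i) ^ 3 = 1 := by
    rw [pow_succ, pow_two, mul, mul,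
      show k + k + i * j + k + (i + i) * j = 3 * (k + i * j) by ring,
      show j + j + j = 3 * j by ring, show i + i + i = 3 * i by ring]
    simp [pow_mul, ha, hb, hc]
  have haQ : a ∈ Q := Subgroup.subset_closure (by simp)
  have hbQ : b ∈ Q := Subgroup.subset_closure (by simp)
  have hcQ : c ∈ Q := Subgroup.subset_closure (by simp)
  have hbZ : b ∈ Z := Subgroup.subset_closure (by simp)
  have form : ∀ g ∈ Q, ∃ k j i : ℕ, g = b ^ k * c ^ j * a ^ i := by
    intro g hg
    induction hg using Subgroup.closure_induction with
    | mem x hx =>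
      rcases hx with rfl | rfl | rfl
      · exact ⟨0, 0, 1, by simp⟩
      · exact ⟨1, 0, 0, by simp⟩
      · exact ⟨0, 1, 0, by simp⟩
    | one => exact ⟨0, 0, 0, by simp⟩
    | mul x y _ _ hx hy =>
      obtain ⟨k, j, i, rfl⟩ := hx
      obtain ⟨k', j', i', rfl⟩ := hy
      exact ⟨_, _, _, mul k j i k' j' i'⟩
    | inv x _ hx =>
      obtain ⟨k, j, i, rfl⟩ := hx
      refine ⟨_, _, _, (inv_eq_of_mul_eq_one_left ?_).trans (mul k j i k j i)⟩
      rw [← pow_two, ← pow_succ, cube]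
  have memQ (k j i : ℕ) : b ^ k * c ^ j * a ^ i ∈ Q :=
    mul_mem (mul_mem (pow_mem hbQ k) (pow_mem hcQ j)) (pow_mem haQ i)
  have central (k j i : ℕ) (h1 : Commute (b ^ k * c ^ j * a ^ i) a)
      (h2 : Commute (b ^ k * c ^ j * a ^ i) c) : 3 ∣ j ∧ 3 ∣ i := by
    constructor
    · have h := h1.eq
      have e1 := mul k j i 0 0 1
      have e2 := mul 0 0 1 k j i
      simp only [pow_zero, one_mul, mul_one, pow_one] at e1 e2
      rw [e1, e2] at h
      simp only [zero_add, add_zero, mul_zero, add_comm 1 i, mul_left_inj, pow_add,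
        left_eq_mul] at h
      exact hbo ▸ orderOf_dvd_of_pow_eq_one h
    · have h := h2.eq
      have e1 := mul k j i 0 1 0
      have e2 := mul 0 1 0 k j i
      simp only [pow_zero, one_mul, mul_one, pow_one] at e1 e2
      rw [e1, e2] at h
      simp only [zero_add, add_zero, zero_mul, add_comm 1 j, mul_left_inj, pow_add,
        mul_eq_left] at h
      exact hbo ▸ orderOf_dvd_of_pow_eq_one h
  have zcomm : ∀ g ∈ Z, ∀ h ∈ Q, Commute g h := by
    intro g hg h hh
    obtain ⟨k, j, i, rfl⟩ := form h hh
    obtain ⟨n, rfl⟩ := Subgroup.mem_closure_singleton.1 hg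
    exact (((Commute.refl b).pow_right k).mul_right (hbc.pow_right j) |>.mul_right
      (hab.symm.pow_right i)).zpow_left n
  have hZQ : Z ≤ Q := (Subgroup.closure_le _).2 (by simpa using hbQ)
  refine ⟨?_, ?_, ?_, ?_, ?_⟩
  · let f : Fin 3 × Fin 3 × Fin 3 → Q := fun p =>
      ⟨b ^ p.1.1 * c ^ p.2.1.1 * a ^ p.2.2.1, memQ _ _ _⟩
    have hf : Function.Bijective f := by
      constructor
      · rintro ⟨k, j, i⟩ ⟨k', j', i'⟩ h
        replace h : b ^ k.1 * c ^ j.1 * a ^ i.1 = b ^ k'.1 * c ^ j'.1 * a ^ i'.1 :=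
          congrArg Subtype.val h
        have h1 : b ^ k.1 * c ^ j.1 * a ^ i.1 * ((b ^ k'.1 * c ^ j'.1 * a ^ i'.1) *
            (b ^ k'.1 * c ^ j'.1 * a ^ i'.1)) = 1 := by
          rw [h, ← pow_two, ← pow_succ', cube]
        rw [mul, mul] at h1
        obtain ⟨hj, hi⟩ := central _ _ _ (h1 ▸ Commute.one_left a) (h1 ▸ Commute.one_left c)
        obtain rfl : j = j' := by omega
        obtain rfl : i = i' := by omega
        rw [mul_left_inj, mul_left_inj, pow_inj_mod, hbo, Nat.mod_eq_of_lt k.2,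
          Nat.mod_eq_of_lt k'.2] at h
        rw [Fin.ext h]
      · rintro ⟨g, hg⟩
        obtain ⟨k, j, i, rfl⟩ := form g hg
        refine ⟨⟨⟨k % 3, Nat.mod_lt _ (by norm_num)⟩, ⟨j % 3, Nat.mod_lt _ (by norm_num)⟩,
          ⟨i % 3, Nat.mod_lt _ (by norm_num)⟩⟩, Subtype.ext ?_⟩
        simp only [f, ← pow_eq_pow_mod _ ha, ← pow_eq_pow_mod _ hb, ← pow_eq_pow_mod _ hc]
    rw [← Nat.card_eq_of_bijective f hf]
    simp
  · intro g hg
    obtain ⟨k, j, i, rfl⟩ := form g hg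
    exact cube k j i
  · ext g
    refine ⟨fun ⟨hg, h⟩ => ?_, fun hg => ⟨hZQ hg, fun h hh => (zcomm g hg h hh).eq⟩⟩
    obtain ⟨k, j, i, rfl⟩ := form g hg
    obtain ⟨⟨j, rfl⟩, ⟨i, rfl⟩⟩ := central k j i (h a haQ) (h c hcQ)
    simpa [pow_mul, ha, hc] using pow_mem hbZ k
  · refine le_antisymm (Subgroup.commutator_le.2 fun g hg h hh => ?_)
      ((Subgroup.closure_le _).2 ?_)
    · obtain ⟨k, j, i, rfl⟩ := form g hg
      obtain ⟨k', j', i', rfl⟩ := form h hh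
      have hgh : b ^ (i' * j) * (b ^ k * c ^ j * a ^ i * (b ^ k' * c ^ j' * a ^ i')) =
          b ^ (i * j') * (b ^ k' * c ^ j' * a ^ i' * (b ^ k * c ^ j * a ^ i)) := by
        rw [mul, mul, add_comm j j', add_comm i i']
        simp only [← mul_assoc, ← pow_add]
        congr 3
        ring
      have : ⁅b ^ k * c ^ j * a ^ i, b ^ k' * c ^ j' * a ^ i'⁆ =
          (b ^ (i' * j))⁻¹ * b ^ (i * j') := by
        rw [commutatorElement_def, mul_inv_eq_iff_eq_mul, mul_inv_eq_iff_eq_mul,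
          mul_assoc ((b ^ (i' * j))⁻¹ * _), mul_assoc (b ^ (i' * j))⁻¹, eq_inv_mul_iff_mul_eq, hgh]
      rw [this]
      exact mul_mem (inv_mem (pow_mem hbZ _)) (pow_mem hbZ _)
    · have : ⁅a, c⁆ = b := by
        rw [commutatorElement_def, hac, mul_inv_cancel_right, mul_inv_cancel_right]
      simpa [this] using Subgroup.commutator_mem_commutator haQ hcQ
  · rw [← hbo, ← Nat.card_zpowers, Subgroup.zpowers_eq_closure]

theorem psuProj_eq_one_of_coe_eq_smul_one {F : Type*} [Field F] (X : ↥(SU3 F)) (s : F)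
    (h : ((X : GL (Fin 3) F) : Matrix (Fin 3) (Fin 3) F) = s • 1) : psuProj F X = 1 := by
  refine (QuotientGroup.eq_one_iff X).2 (Subgroup.mem_center_iff.2 fun g => ?_)
  ext1
  apply Units.ext
  simp [h]

theorem psuProj_eq_of_coe_eq_smul {F : Type*} [Field F] (X Y : ↥(SU3 F)) (s : F)
    (h : ((X : GL (Fin 3) F) : Matrix (Fin 3) (Fin 3) F) =
      s • ((Y : GL (Fin 3) F) : Matrix (Fin 3) (Fin 3) F)) : psuProj F X = psuProj F Y := by
  rw [← mul_inv_eq_one, ← map_inv, ← map_mul]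
  refine psuProj_eq_one_of_coe_eq_smul_one _ s ?_
  rw [Subgroup.coe_mul, Units.val_mul, h, Subgroup.coe_inv, smul_mul_assoc, Units.mul_inv]

/-- in PSU₃(8), Q₂ = ⟨Ā,B̄,C̄⟩ has order 27 and exponent 3, and
its center and commutator subgroup both equal ⟨B̄⟩, which has order 3: Q₂ is
extraspecial of order 27 and exponent 3. -/
theorem stmt_9 (F : Type*) [Field F] [Fintype F] (hF : Fintype.card F = 64)
    (ζ : Fˣ) (hζ : ∀ x : Fˣ, x ∈ Subgroup.zpowers ζ)
    (β α : F) (hβ : β = (ζ : F) ^ 7) (hα : α = β ^ 3)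
    (A B C : ↥(SU3 F))
    (hA : ((A : GL (Fin 3) F) : Matrix (Fin 3) (Fin 3) F) = !![0,0,1; 1,0,0; 0,1,0])
    (hB : ((B : GL (Fin 3) F) : Matrix (Fin 3) (Fin 3) F) = !![1,0,0; 0,α,0; 0,0,α⁻¹])
    (hC : ((C : GL (Fin 3) F) : Matrix (Fin 3) (Fin 3) F) = !![β,0,0; 0,β^4,0; 0,0,β^4]) :
    ∀ Q₂ Zb : Subgroup (PSU3 F),
      Q₂ = Subgroup.closure {psuProj F A, psuProj F B, psuProj F C} →
      Zb = Subgroup.closure {psuProj F B} →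
      Nat.card Q₂ = 27 ∧ (∀ g ∈ Q₂, g ^ 3 = 1) ∧
      {g | g ∈ Q₂ ∧ ∀ h ∈ Q₂, g * h = h * g} = (Zb : Set (PSU3 F)) ∧
      ⁅Q₂, Q₂⁆ = Zb ∧ Nat.card Zb = 3 := by
  rintro _ _ rfl rfl
  have hord : orderOf ζ = 63 := by
    rw [orderOf_eq_card_of_forall_mem_zpowers hζ, Nat.card_units, Nat.card_eq_fintype_card, hF]
  have hβ9 : β ^ 9 = 1 := by
    have h : ζ ^ 63 = 1 := hord ▸ pow_orderOf_eq_one ζ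
    rw [hβ, ← pow_mul, ← Units.val_pow_eq_pow_val, h, Units.val_one]
  have hα3 : α ^ 3 = 1 := by rw [hα, ← pow_mul, hβ9]
  have hα1 : α ≠ 1 := by
    intro h
    rw [hα, hβ, ← pow_mul] at h
    have h' : ζ ^ 21 = 1 := Units.ext (by simpa using h)
    have := Nat.le_of_dvd (by norm_num) (hord ▸ orderOf_dvd_of_pow_eq_one h')
    omega
  have hαi : α⁻¹ = α ^ 2 := inv_eq_of_mul_eq_one_left (by rw [← pow_succ, hα3])
  rw [hαi] at hB
  refine extraspecial_of_heisenberg ?_ ?_ ?_ ?_ ?_ ?_ ?_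
  · rw [← map_pow]
    refine psuProj_eq_one_of_coe_eq_smul_one _ 1 ?_
    ext i j
    fin_cases i <;> fin_cases j <;> simp [hA, pow_succ, Matrix.mul_apply, Fin.sum_univ_three]
  · rw [← map_pow]
    refine psuProj_eq_one_of_coe_eq_smul_one _ 1 ?_
    ext i j
    fin_cases i <;> fin_cases j <;> simp [hB, pow_succ, Matrix.mul_apply, Fin.sum_univ_three] <;>
      grind
  · rw [← map_pow]
    refine psuProj_eq_one_of_coe_eq_smul_one _ α ?_
    ext i j
    fin_cases i <;> fin_cases j <;> simp [hC, pow_succ, Matrix.mul_apply, Fin.sum_univ_three] <;>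
      grind
  · intro h
    have h' := Subgroup.mem_center_iff.1 ((QuotientGroup.eq_one_iff B).1 h) A
    have h2 := congrArg
      (fun M : ↥(SU3 F) => ((M : GL (Fin 3) F) : Matrix (Fin 3) (Fin 3) F) 1 0) h'
    simp [hA, hB, Matrix.mul_apply, Fin.sum_univ_three] at h2
    exact hα1 h2.symm
  · rw [Commute, SemiconjBy, ← map_mul, ← map_mul]
    refine psuProj_eq_of_coe_eq_smul _ _ (α ^ 2) ?_
    ext i j
    fin_cases i <;> fin_cases j <;> simp [hA, hB, Matrix.mul_apply, Fin.sum_univ_three] <;>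
      grind
  · rw [Commute, SemiconjBy, ← map_mul, ← map_mul]
    refine psuProj_eq_of_coe_eq_smul _ _ 1 ?_
    ext i j
    fin_cases i <;> fin_cases j <;> simp [hB, hC, Matrix.mul_apply, Fin.sum_univ_three] <;>
      grind
  · rw [← map_mul, ← map_mul, ← map_mul]
    refine psuProj_eq_of_coe_eq_smul _ _ α ?_
    ext i j
    fin_cases i <;> fin_cases j <;> simp [hA, hB, hC, Matrix.mul_apply, Fin.sum_univ_three] <;>
      grind
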